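/- For the ERGM(β⃗) measure π on 𝒢_n (any β_1,…,β_s > 0), for every configuration x ∈ 𝒢_n and all distinct edges e, f of K_n: d_TV(π_e(·|x_{f+}), π_e(·|x_{f−})) = Φ(∂_e H(x_{f+})) − Φ(∂_e H(x_{f−})) ≤ (1/4) ∂_{ef}H(x) = (1/4) Σ_{i=1}^s β_i N_{G_i}(x,e,f)/n^{|V_i|−2} ≤ L_{ef}, where Φ(u) = e^u/(1+e^u), ∂_{ef}H(x) = ∂_e H(x_{f+}) − ∂_e H(x_{f−}), and L_{ef} = (1/4) Σ_{i=1}^s β_i N_{G_i}(K_n,e,f)/n^{|V_i|−2}. In particular the Dobrushin interdependence matrix entries a_{ef} = sup_x d_TV(π_e(·|x_{f+}), π_e(·|x_{f−})) satisfy a_{ef} ≤ L_{ef}. -/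

import Mathlib

open Finset MeasureTheory Filter
open scoped ENNReal NNReal

namespace ERGM

/-- The set of edges of the complete graph on `Fin n`: non-diagonal unordered pairs. -/
abbrev EdgeSet (n : ℕ) : Type := {p : Sym2 (Fin n) // ¬ p.IsDiag}

/-- A configuration (graph on `n` vertices): an assignment of `true/false` to each edge. -/
abbrev Config (n : ℕ) : Type := EdgeSet n → Bool

/-- The value of the configuration `x` on the (unordered) pair `{i,j}`; `false` for `i = j`. -/
noncomputable def edgeVal {n : ℕ} (x : Config n) (i j : Fin n) : Bool :=
  if h : (s(i, j) : Sym2 (Fin n)).IsDiag then false else x ⟨s(i, j), h⟩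

/-- Real-valued indicator of presence of the edge `{i,j}` in `x`. -/
noncomputable def edgeInd {n : ℕ} (x : Config n) (i j : Fin n) : ℝ :=
  if edgeVal x i j = true then 1 else 0

open scoped Classical in
/-- Subgraph counting number `N_G(x)`: the number of copies of `G` in `x` (times the
number of automorphisms), i.e. the sum over injective `ψ` of the product of edge
indicators (each edge indicator is idempotent, so counting ordered adjacent pairs
yields the same value as counting edges). -/
noncomputable def NG {n m : ℕ} (G : SimpleGraph (Fin m)) (x : Config n) : ℝ :=
  ∑ ψ : Fin m ↪ Fin n, ∏ a : Fin m, ∏ b : Fin m,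
    if G.Adj a b then edgeInd x (ψ a) (ψ b) else 1

/-- The Hamiltonian `H(x) = Σ_i β_i N_{G_i}(x) / n^{|V_i|-2}`. -/
noncomputable def Hamiltonian {n s : ℕ} (V : Fin s → ℕ)
    (G : ∀ i, SimpleGraph (Fin (V i))) (β : Fin s → ℝ) (x : Config n) : ℝ :=
  ∑ i, β i * NG (G i) x / (n : ℝ) ^ (V i - 2)

/-- The ERGM probability mass function `π(x) ∝ exp(H(x))`. -/
noncomputable def ergmProb {n s : ℕ} (V : Fin s → ℕ)
    (G : ∀ i, SimpleGraph (Fin (V i))) (β : Fin s → ℝ) (x : Config n) : ℝ :=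
  Real.exp (Hamiltonian V G β x) / ∑ y : Config n, Real.exp (Hamiltonian V G β y)

/-- Expectation of `f` with respect to the mass function `w`. -/
noncomputable def expect {n : ℕ} (w : Config n → ℝ) (f : Config n → ℝ) : ℝ :=
  ∑ x : Config n, w x * f x

open scoped Classical in
/-- Probability of the event `A` with respect to the mass function `w`. -/
noncomputable def prob {n : ℕ} (w : Config n → ℝ) (A : Config n → Prop) : ℝ :=
  ∑ x : Config n, if A x then w x else 0

/-- The number of edges `|E(G)|` of a finite graph. -/
noncomputable def numEdges {m : ℕ} (G : SimpleGraph (Fin m)) : ℕ := G.edgeSet.ncard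

/-- `Ψ_β(p) = Σ_i 2 β_i |E_i| p^{|E_i|-1}`. -/
noncomputable def Psi {s : ℕ} (V : Fin s → ℕ) (G : ∀ i, SimpleGraph (Fin (V i)))
    (β : Fin s → ℝ) (p : ℝ) : ℝ :=
  ∑ i, 2 * β i * (numEdges (G i) : ℝ) * p ^ (numEdges (G i) - 1)

/-- `Φ(u) = e^u / (1 + e^u)`. -/
noncomputable def Phi (u : ℝ) : ℝ := Real.exp u / (1 + Real.exp u)

/-- `φ_β(p) = Φ(Ψ_β(p))`. -/
noncomputable def phiFn {s : ℕ} (V : Fin s → ℕ) (G : ∀ i, SimpleGraph (Fin (V i)))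
    (β : Fin s → ℝ) : ℝ → ℝ := fun p => Phi (Psi V G β p)

/-- `β` is sub-critical (high temperature) with fixed point `p`: `p` is the unique
solution of `φ_β(p) = p` and it satisfies `φ_β'(p) < 1`. -/
def Subcritical {s : ℕ} (V : Fin s → ℕ) (G : ∀ i, SimpleGraph (Fin (V i)))
    (β : Fin s → ℝ) (p : ℝ) : Prop :=
  phiFn V G β p = p ∧ (∀ q : ℝ, phiFn V G β q = q → q = p) ∧
    deriv (phiFn V G β) p < 1

/-- The discrete derivative `∂_e H(x) = H(x_{e+}) - H(x_{e-})`. -/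
noncomputable def dHam {n s : ℕ} (V : Fin s → ℕ) (G : ∀ i, SimpleGraph (Fin (V i)))
    (β : Fin s → ℝ) (e : EdgeSet n) (x : Config n) : ℝ :=
  Hamiltonian V G β (Function.update x e true) - Hamiltonian V G β (Function.update x e false)

/-- Real-valued indicator `X_e` of presence of edge `e`. -/
noncomputable def edgeX {n : ℕ} (e : EdgeSet n) (x : Config n) : ℝ := if x e = true then 1 else 0

/-- Two edges of `K_n` share a vertex. -/
def ShareVertex {n : ℕ} (e f : EdgeSet n) : Prop := ∃ v : Fin n, v ∈ e.1 ∧ v ∈ f.1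


/-- The conditional probability `π_e(1 | x̄_e)` that edge `e` is present given the
other coordinates of `x`. -/
noncomputable def condOne {n s : ℕ} (V : Fin s → ℕ) (G : ∀ i, SimpleGraph (Fin (V i)))
    (β : Fin s → ℝ) (x : Config n) (e : EdgeSet n) : ℝ :=
  ergmProb V G β (Function.update x e true) /
    (ergmProb V G β (Function.update x e true) + ergmProb V G β (Function.update x e false))

open scoped Classical in
/-- `N_G(x,e,f)`: the number of injective `ψ` mapping all edges of `G` to edges present
in `x_{ef,+}`, with one edge of `G` mapping onto `e` and another onto `f`
(by convention `N_G(x,e,e) = 0`). -/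
noncomputable def NGef {n m : ℕ} (G : SimpleGraph (Fin m)) (x : Config n)
    (e f : EdgeSet n) : ℝ :=
  if e = f then 0 else
    ∑ ψ : Fin m ↪ Fin n,
      if (∀ a b : Fin m, G.Adj a b →
            edgeVal (Function.update (Function.update x e true) f true) (ψ a) (ψ b) = true) ∧
         (∃ a b : Fin m, G.Adj a b ∧ (s(ψ a, ψ b) : Sym2 (Fin n)) = e.1) ∧
         (∃ a b : Fin m, G.Adj a b ∧ (s(ψ a, ψ b) : Sym2 (Fin n)) = f.1) then 1 else 0

/-- The matrix `L` with `L_{ef} = (1/4) Σ_i β_i N_{G_i}(K_n,e,f) / n^{|V_i|-2}`. -/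
noncomputable def Lmat {n s : ℕ} (V : Fin s → ℕ) (G : ∀ i, SimpleGraph (Fin (V i)))
    (β : Fin s → ℝ) (e f : EdgeSet n) : ℝ :=
  (1 / 4) * ∑ i, β i * NGef (G i) (fun _ => true) e f / (n : ℝ) ^ (V i - 2)

/-- The edge `g` of `K_n` is the image under `ψ` of an edge of `G`. -/
def IsImageEdge {n m : ℕ} (G : SimpleGraph (Fin m)) (ψ : Fin m ↪ Fin n) (g : EdgeSet n) : Prop :=
  ∃ a b : Fin m, G.Adj a b ∧ (s(ψ a, ψ b) : Sym2 (Fin n)) = g.1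

theorem forall_adj_edgeVal_iff {n m : ℕ} (G : SimpleGraph (Fin m)) (ψ : Fin m ↪ Fin n)
    (x : Config n) :
    (∀ a b, G.Adj a b → edgeVal x (ψ a) (ψ b) = true) ↔
      ∀ g, IsImageEdge G ψ g → x g = true := by
  constructor
  · rintro h g ⟨a, b, hab, hg⟩
    have h1 := h a b hab
    unfold edgeVal at h1
    split_ifs at h1 with hd
    rwa [← (Subtype.ext hg : (⟨s(ψ a, ψ b), hd⟩ : EdgeSet n) = g)]
  · intro h a b hab
    have hd : ¬ (s(ψ a, ψ b) : Sym2 (Fin n)).IsDiag := by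
      rw [Sym2.mk_isDiag_iff]
      exact fun h' => hab.ne (ψ.injective h')
    unfold edgeVal
    rw [dif_neg hd]
    exact h _ ⟨a, b, hab, rfl⟩

open scoped Classical in
theorem NG_eq_sum_ite {n m : ℕ} (G : SimpleGraph (Fin m)) (x : Config n) :
    NG G x = ∑ ψ : Fin m ↪ Fin n, if ∀ g, IsImageEdge G ψ g → x g = true then 1 else 0 := by
  unfold NG
  refine Finset.sum_congr rfl fun ψ _ => ?_
  simp only [← forall_adj_edgeVal_iff]
  split_ifs with h
  · refine Finset.prod_eq_one fun a _ => Finset.prod_eq_one fun b _ => ?_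
    split_ifs with hab
    · simp [edgeInd, h a b hab]
    · rfl
  · push Not at h
    obtain ⟨a, b, hab, hx⟩ := h
    refine Finset.prod_eq_zero (Finset.mem_univ a) (Finset.prod_eq_zero (Finset.mem_univ b) ?_)
    simp [hab, edgeInd, hx]

theorem forall_update_update_iff {ι : Type*} [DecidableEq ι] (S : ι → Prop) (x : ι → Bool)
    {e f : ι} (hef : e ≠ f) (b c : Bool) :
    (∀ g, S g → Function.update (Function.update x f c) e b g = true) ↔
      (∀ g, g ≠ e → g ≠ f → S g → x g = true) ∧ (S e → b = true) ∧ (S f → c = true) := by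
  constructor
  · refine fun h => ⟨fun g he hf hg => ?_, fun he => ?_, fun hf => ?_⟩
    · simpa [he, hf] using h g hg
    · simpa using h e he
    · simpa [hef.symm] using h f hf
  · rintro ⟨h, he, hf⟩ g hg
    by_cases hge : g = e
    · subst hge
      simpa using he hg
    · by_cases hgf : g = f
      · subst hgf
        simpa [hge] using hf hg
      · simpa [hge, hgf] using h g hge hgf hg

open scoped Classical in
/-- The mixed second difference of the indicator that `x` is `true` on `S`. -/
theorem indicator_second_difference {ι : Type*} [DecidableEq ι] (S : ι → Prop) (x : ι → Bool)
    {e f : ι} (hef : e ≠ f) :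
    ((if ∀ g, S g → Function.update (Function.update x f true) e true g = true
        then (1 : ℝ) else 0) -
      (if ∀ g, S g → Function.update (Function.update x f true) e false g = true
        then 1 else 0)) -
      ((if ∀ g, S g → Function.update (Function.update x f false) e true g = true
        then 1 else 0) -
      (if ∀ g, S g → Function.update (Function.update x f false) e false g = true
        then 1 else 0)) =
    if (∀ g, S g → Function.update (Function.update x f true) e true g = true) ∧ S e ∧ S f
      then 1 else 0 := by
  simp only [forall_update_update_iff S x hef]
  by_cases hC : ∀ g, g ≠ e → g ≠ f → S g → x g = true <;>
    by_cases he : S e <;> by_cases hf : S f <;> simp [hC, he, hf]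

open scoped Classical in
theorem NGef_eq_sum_ite {n m : ℕ} (G : SimpleGraph (Fin m)) (x : Config n) {e f : EdgeSet n}
    (hef : e ≠ f) :
    NGef G x e f = ∑ ψ : Fin m ↪ Fin n,
      if (∀ g, IsImageEdge G ψ g →
          Function.update (Function.update x f true) e true g = true) ∧
        IsImageEdge G ψ e ∧ IsImageEdge G ψ f then 1 else 0 := by
  unfold NGef
  rw [if_neg hef]
  refine Finset.sum_congr rfl fun ψ _ => ?_
  rw [Function.update_comm hef.symm]
  simp only [forall_adj_edgeVal_iff]
  exact if_congr Iff.rfl rfl rfl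

theorem NG_second_difference {n m : ℕ} (G : SimpleGraph (Fin m)) (x : Config n) {e f : EdgeSet n}
    (hef : e ≠ f) :
    (NG G (Function.update (Function.update x f true) e true) -
      NG G (Function.update (Function.update x f true) e false)) -
      (NG G (Function.update (Function.update x f false) e true) -
      NG G (Function.update (Function.update x f false) e false)) = NGef G x e f := by
  classical
  simp only [NG_eq_sum_ite, NGef_eq_sum_ite G x hef, ← Finset.sum_sub_distrib]
  refine Finset.sum_congr rfl fun ψ _ => ?_
  convert indicator_second_difference (IsImageEdge G ψ) x hef

theorem NGef_nonneg {n m : ℕ} (G : SimpleGraph (Fin m)) (x : Config n) (e f : EdgeSet n) :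
    0 ≤ NGef G x e f := by
  unfold NGef
  split_ifs
  · exact le_rfl
  · exact Finset.sum_nonneg fun ψ _ => by split_ifs <;> norm_num

theorem NGef_le_NGef_complete {n m : ℕ} (G : SimpleGraph (Fin m)) (x : Config n)
    {e f : EdgeSet n} (hef : e ≠ f) : NGef G x e f ≤ NGef G (fun _ => true) e f := by
  classical
  rw [NGef_eq_sum_ite G _ hef, NGef_eq_sum_ite G _ hef]
  refine Finset.sum_le_sum fun ψ _ => ?_
  split_ifs with h h'
  · exact le_rfl
  · refine absurd ⟨?_, h.2⟩ h'
    intro g _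
    simp [Function.update_apply]
  · exact zero_le_one
  · exact le_rfl

theorem dHam_second_difference {n s : ℕ} (V : Fin s → ℕ) (G : ∀ i, SimpleGraph (Fin (V i)))
    (β : Fin s → ℝ) (x : Config n) {e f : EdgeSet n} (hef : e ≠ f) :
    dHam V G β e (Function.update x f true) - dHam V G β e (Function.update x f false) =
      ∑ i, β i * NGef (G i) x e f / (n : ℝ) ^ (V i - 2) := by
  simp only [dHam, Hamiltonian, ← Finset.sum_sub_distrib]
  refine Finset.sum_congr rfl fun i _ => ?_
  rw [← NG_second_difference (G i) x hef]
  ring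

theorem condOne_eq_Phi {n s : ℕ} (V : Fin s → ℕ) (G : ∀ i, SimpleGraph (Fin (V i)))
    (β : Fin s → ℝ) (x : Config n) (e : EdgeSet n) :
    condOne V G β x e = Phi (dHam V G β e x) := by
  have hZ : 0 < ∑ y : Config n, Real.exp (Hamiltonian V G β y) :=
    Finset.sum_pos (fun _ _ => Real.exp_pos _) Finset.univ_nonempty
  unfold condOne Phi dHam ergmProb
  rw [Real.exp_sub]
  have h1 := Real.exp_pos (Hamiltonian V G β (Function.update x e true))
  have h2 := Real.exp_pos (Hamiltonian V G β (Function.update x e false))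
  field_simp
  ring

theorem hasDerivAt_Phi (u : ℝ) : HasDerivAt Phi (Real.exp u / (1 + Real.exp u) ^ 2) u := by
  have h := (Real.hasDerivAt_exp u).div ((Real.hasDerivAt_exp u).const_add 1)
    (by positivity : 1 + Real.exp u ≠ 0)
  exact h.congr_deriv (by ring)

theorem Phi_monotone : Monotone Phi :=
  monotone_of_deriv_nonneg (fun u => (hasDerivAt_Phi u).differentiableAt) fun u => by
    rw [(hasDerivAt_Phi u).deriv]
    positivity

theorem Phi_sub_le {u v : ℝ} (h : v ≤ u) : Phi u - Phi v ≤ 1 / 4 * (u - v) := by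
  refine image_sub_le_mul_sub_of_deriv_le (fun u => (hasDerivAt_Phi u).differentiableAt)
    (fun u => ?_) h
  rw [(hasDerivAt_Phi u).deriv, div_le_iff₀ (by positivity)]
  nlinarith [sq_nonneg (1 - Real.exp u)]

/-- **(Equation (201)/(202): Dobrushin-type bound on the conditional TV distance).**
For every `x` and distinct edges `e ≠ f`,
`d_TV(π_e(·|x_{f+}), π_e(·|x_{f-})) = Φ(∂_e H(x_{f+})) - Φ(∂_e H(x_{f-}))
  ≤ (1/4) ∂_{ef} H(x) = (1/4) Σ_i β_i N_{G_i}(x,e,f)/n^{|V_i|-2} ≤ L_{ef}`,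
and in particular `a_{ef} = sup_x d_TV(π_e(·|x_{f+}), π_e(·|x_{f-})) ≤ L_{ef}`. -/
theorem conditional_tv_bound {s : ℕ} (V : Fin s → ℕ)
    (G : ∀ i, SimpleGraph (Fin (V i))) (β : Fin s → ℝ) (hβ : ∀ i, 0 < β i) :
    ∀ n : ℕ, ∀ x : Config n, ∀ e f : EdgeSet n, e ≠ f →
      (|condOne V G β (Function.update x f true) e -
          condOne V G β (Function.update x f false) e| =
        Phi (dHam V G β e (Function.update x f true)) -
          Phi (dHam V G β e (Function.update x f false))) ∧
      (Phi (dHam V G β e (Function.update x f true)) -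
          Phi (dHam V G β e (Function.update x f false)) ≤
        (1 / 4) * (dHam V G β e (Function.update x f true) -
          dHam V G β e (Function.update x f false))) ∧
      ((1 / 4) * (dHam V G β e (Function.update x f true) -
          dHam V G β e (Function.update x f false)) =
        (1 / 4) * ∑ i, β i * NGef (G i) x e f / (n : ℝ) ^ (V i - 2)) ∧
      ((1 / 4) * ∑ i, β i * NGef (G i) x e f / (n : ℝ) ^ (V i - 2) ≤ Lmat V G β e f) ∧
      ((⨆ x' : Config n,
          |condOne V G β (Function.update x' f true) e -
            condOne V G β (Function.update x' f false) e|) ≤ Lmat V G β e f) := by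
  intro n x e f hef
  have hle (y : Config n) : dHam V G β e (Function.update y f false) ≤
      dHam V G β e (Function.update y f true) := by
    rw [← sub_nonneg, dHam_second_difference V G β y hef]
    exact Finset.sum_nonneg fun i _ =>
      div_nonneg (mul_nonneg (hβ i).le (NGef_nonneg _ _ _ _)) (by positivity)
  have habs (y : Config n) : |condOne V G β (Function.update y f true) e -
      condOne V G β (Function.update y f false) e| =
      Phi (dHam V G β e (Function.update y f true)) -
        Phi (dHam V G β e (Function.update y f false)) := by
    rw [condOne_eq_Phi, condOne_eq_Phi, abs_of_nonneg (sub_nonneg.2 (Phi_monotone (hle y)))]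
  have hL (y : Config n) :
      (1 / 4) * ∑ i, β i * NGef (G i) y e f / (n : ℝ) ^ (V i - 2) ≤ Lmat V G β e f := by
    unfold Lmat
    have := fun i => (hβ i).le
    gcongr with i
    · exact this i
    · exact NGef_le_NGef_complete (G i) y hef
  refine ⟨habs x, Phi_sub_le (hle x), by rw [dHam_second_difference V G β x hef], hL x,
    ciSup_le fun y => ?_⟩
  rw [habs y]
  refine (Phi_sub_le (hle y)).trans ?_
  rw [dHam_second_difference V G β y hef]
  exact hL y

end ERGM
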